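/- arXiv:2007.00033 — 3 statements merged into one kernel-verified Lean document; each statement's English description precedes it below -/
import Mathlib

section
/- Let m be a positive integer. For all z, b ∈ {−1,0,1}^m and all v ∈ ℤ^{3m}: v = enc₃(z) if and only if φ′_b(v) = enc₃([z + b]₃). -/
/-- `[a]₃`: the unique element of `{-1, 0, 1}` congruent to `a` modulo `3`. -/
def bal3 (a : ℤ) : ℤ := if a % 3 = 2 then -1 else a % 3

/-- The slot (of a block of three coordinates, labelled `-1, 0, 1` in order)
corresponding to the residue `[c]₃`. -/
def slot3 (c : ℤ) : Fin 3 := if bal3 c = -1 then 0 else if bal3 c = 0 then 1 else 2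

/-- `enc₃(z) ∈ {-1,0,1}^{3m}`: the block of coordinates corresponding to `i` is
`([z_i + 1]₃, [z_i]₃, [z_i − 1]₃)`, i.e. the entry in slot `(i, j)` (where slot `j`
carries the label `c = j - 1 ∈ {-1,0,1}`) equals `[z_i − c]₃`. -/
def enc3 {m : ℕ} (z : Fin m → ℤ) : Fin m × Fin 3 → ℤ :=
  fun p => bal3 (z p.1 - ((p.2 : ℤ) - 1))

/-- The permutation `φ′_b` of `ℤ^{3m}`: writing `v = (v_1^{(-1)}, v_1^{(0)}, v_1^{(1)}, …)`,
the `i`-th block of `φ′_b(v)` is `(v_i^{([-b_i-1]₃)}, v_i^{([-b_i]₃)}, v_i^{([-b_i+1]₃)})`,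
i.e. the entry of `φ′_b(v)` in the slot labelled `c` is `v_i^{([c - b_i]₃)}`. -/
def phi3 {m : ℕ} (b : Fin m → ℤ) (v : Fin m × Fin 3 → ℤ) : Fin m × Fin 3 → ℤ :=
  fun p => v (p.1, slot3 (((p.2 : ℤ) - 1) - b p.1))

theorem bal3_eq_bal3_of_emod_eq {a c : ℤ} (h : a % 3 = c % 3) : bal3 a = bal3 c := by
  simp only [bal3, h]

theorem bal3_emod_three (a : ℤ) : bal3 a % 3 = a % 3 := by
  unfold bal3
  split_ifs <;> omega

/-- The label of the slot `slot3 c` is `[c]₃`. -/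
theorem slot3_label (c : ℤ) : ((slot3 c : Fin 3) : ℤ) - 1 = bal3 c := by
  unfold slot3 bal3
  split_ifs <;> simp <;> omega

/-- The slot whose label is congruent to `c` is `slot3 c`. -/
theorem slot3_eq_of_emod_eq {c : ℤ} {j : Fin 3} (h : c % 3 = ((j : ℤ) - 1) % 3) :
    slot3 c = j := by
  have hc := slot3_label c
  have hm := bal3_emod_three c
  apply Fin.ext
  omega

theorem phi3_injective {m : ℕ} (b : Fin m → ℤ) : Function.Injective (phi3 b) := by
  intro v w h
  funext ⟨i, j⟩
  have key := congrFun h (i, slot3 ((j : ℤ) - 1 + b i))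
  have hj : slot3 (((slot3 ((j : ℤ) - 1 + b i) : Fin 3) : ℤ) - 1 - b i) = j := by
    apply slot3_eq_of_emod_eq
    rw [slot3_label]
    have := bal3_emod_three ((j : ℤ) - 1 + b i)
    omega
  simpa only [phi3, hj] using key

theorem phi3_enc3 {m : ℕ} (z b : Fin m → ℤ) :
    phi3 b (enc3 z) = enc3 fun i => bal3 (z i + b i) := by
  funext ⟨i, j⟩
  simp only [phi3, enc3, slot3_label]
  apply bal3_eq_bal3_of_emod_eq
  have h₁ := bal3_emod_three ((j : ℤ) - 1 - b i)
  have h₂ := bal3_emod_three (z i + b i)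
  omega

/-- For all `z, b ∈ {-1,0,1}^m` and all `v ∈ ℤ^{3m}`:
`v = enc₃(z)` iff `φ′_b(v) = enc₃([z + b]₃)`. -/
theorem enc3_phi3_equiv (m : ℕ) (hm : 0 < m) (z b : Fin m → ℤ)
    (hz : ∀ i, z i = -1 ∨ z i = 0 ∨ z i = 1)
    (hb : ∀ i, b i = -1 ∨ b i = 0 ∨ b i = 1)
    (v : Fin m × Fin 3 → ℤ) :
    v = enc3 z ↔ phi3 b v = enc3 fun i => bal3 (z i + b i) := by
  rw [← phi3_enc3, (phi3_injective b).eq_iff]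
end

section
/- For all t, b ∈ {0,1}, all z, e ∈ {−1,0,1}, and all v ∈ ℤ^6: v = ext(t, z) if and only if ψ_{b,e}(v) = ext(t ⊕ b, [z + e]₃). -/
/-- The bit `[a]₂ ∈ {0,1}` congruent to `a` modulo `2` (so `t ⊕ b = [t + b]₂`). -/
def bal2 (a : ℤ) : ℤ := a % 2

/-- The slot in a block of two coordinates (labelled `0, 1` in order)
corresponding to the residue `[c]₂`. -/
def slot2 (c : ℤ) : Fin 2 := if bal2 c = 1 then 1 else 0

/-- `ext(t, z) = (t̄·[z+1]₃, t·[z+1]₃, t̄·[z]₃, t·[z]₃, t̄·[z−1]₃, t·[z−1]₃) ∈ ℤ^6`,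
indexed by pairs `(s, j)` with `s ∈ {0,1}` and slot `j` carrying label `c = j - 1`:
the entry at `(s, c)` is `[z − c]₃` if `s = t`, and `0` otherwise. -/
def ext (t z : ℤ) : Fin 2 × Fin 3 → ℤ :=
  fun p => if (p.1 : ℤ) = t then bal3 (z - ((p.2 : ℤ) - 1)) else 0

/-- The permutation `ψ_{b,e}` of `ℤ^6`: writing
`v = (v^{(0,−1)}, v^{(1,−1)}, v^{(0,0)}, v^{(1,0)}, v^{(0,1)}, v^{(1,1)})`, it outputs
`(v^{(b,[−e−1]₃)}, v^{(b̄,[−e−1]₃)}, v^{(b,[−e]₃)}, v^{(b̄,[−e]₃)}, v^{(b,[−e+1]₃)}, v^{(b̄,[−e+1]₃)})`,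
i.e. its entry at `(s, c)` is `v^{([s+b]₂, [c−e]₃)}`. -/
def psi (b e : ℤ) (v : Fin 2 × Fin 3 → ℤ) : Fin 2 × Fin 3 → ℤ :=
  fun p => v (slot2 ((p.1 : ℤ) + b), slot3 (((p.2 : ℤ) - 1) - e))

/-- `ψ_{b,e}` permutes the coordinates, so it is injective. -/
theorem psi_injective {b e : ℤ} (hb : b = 0 ∨ b = 1) (he : e = -1 ∨ e = 0 ∨ e = 1) :
    Function.Injective (psi b e) := by
  have hσ : Function.Surjective fun p : Fin 2 × Fin 3 =>
      (slot2 ((p.1 : ℤ) + b), slot3 (((p.2 : ℤ) - 1) - e)) := by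
    rcases hb with rfl | rfl <;> rcases he with rfl | rfl | rfl <;> decide
  exact hσ.injective_comp_right

/-- `ψ_{b,e}` maps `ext(t, z)` to `ext(t ⊕ b, [z + e]₃)`. -/
theorem psi_ext {t b z e : ℤ} (ht : t = 0 ∨ t = 1) (hb : b = 0 ∨ b = 1)
    (hz : z = -1 ∨ z = 0 ∨ z = 1) (he : e = -1 ∨ e = 0 ∨ e = 1) :
    psi b e (ext t z) = ext (bal2 (t + b)) (bal3 (z + e)) := by
  rcases ht with rfl | rfl <;> rcases hb with rfl | rfl <;>
    rcases hz with rfl | rfl | rfl <;> rcases he with rfl | rfl | rfl <;> decide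

/-- For all `t, b ∈ {0,1}`, all `z, e ∈ {-1,0,1}`, and all `v ∈ ℤ^6`:
`v = ext(t, z)` iff `ψ_{b,e}(v) = ext(t ⊕ b, [z + e]₃)`. -/
theorem ext_psi_equiv (t b z e : ℤ) (ht : t = 0 ∨ t = 1) (hb : b = 0 ∨ b = 1)
    (hz : z = -1 ∨ z = 0 ∨ z = 1) (he : e = -1 ∨ e = 0 ∨ e = 1)
    (v : Fin 2 × Fin 3 → ℤ) :
    v = ext t z ↔ psi b e v = ext (bal2 (t + b)) (bal3 (z + e)) := by
  rw [← psi_ext ht hb hz he, (psi_injective hb he).eq_iff]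
end

section
/- Let valid_e = { ext(t, z) : t ∈ {0,1}, z ∈ {−1,0,1} } ⊆ {−1,0,1}^6. Then the map (t, z) ↦ ext(t, z) is injective (so valid_e has exactly 6 elements), and for every fixed v ∈ valid_e the map (b, e) ↦ ψ_{b,e}(v) is a bijection from {0,1} × {−1,0,1} onto valid_e; consequently, if v ∈ valid_e and (b, e) is chosen uniformly at random from {0,1} × {−1,0,1}, then ψ_{b,e}(v) is uniformly distributed on valid_e. -/
/-- The parameter set `{0,1} × {-1,0,1}`. -/
def bitTrit : Set (ℤ × ℤ) :=
  {p | (p.1 = 0 ∨ p.1 = 1) ∧ (p.2 = -1 ∨ p.2 = 0 ∨ p.2 = 1)}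

/-- `{0,1} × {-1,0,1}` as a `Finset`. -/
def bitTritFinset : Finset (ℤ × ℤ) := ({0, 1} : Finset ℤ) ×ˢ ({-1, 0, 1} : Finset ℤ)

/-- `valid_e = { ext(t, z) : t ∈ {0,1}, z ∈ {-1,0,1} }`. -/
def validE : Set (Fin 2 × Fin 3 → ℤ) := (fun p : ℤ × ℤ => ext p.1 p.2) '' bitTrit

theorem coe_bitTritFinset : (bitTritFinset : Set (ℤ × ℤ)) = bitTrit := by
  ext p
  simp [bitTritFinset, bitTrit]

theorem coe_image_ext :
    ((bitTritFinset.image fun p : ℤ × ℤ => ext p.1 p.2 : Finset (Fin 2 × Fin 3 → ℤ)) :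
      Set (Fin 2 × Fin 3 → ℤ)) = validE := by
  rw [Finset.coe_image, coe_bitTritFinset, validE]

theorem injOn_ext : Set.InjOn (fun p : ℤ × ℤ => ext p.1 p.2) bitTritFinset := by
  have h : ∀ p ∈ bitTritFinset, ∀ q ∈ bitTritFinset, ext p.1 p.2 = ext q.1 q.2 → p = q := by
    decide +kernel
  exact fun p hp q hq => h p hp q hq

/-- `ψ_{b,e}` shifts the parameters of `ext(t, z)` by `(b, e)`. -/
theorem psi_ext_s9 : ∀ p ∈ bitTritFinset, ∀ q ∈ bitTritFinset,
    psi q.1 q.2 (ext p.1 p.2) = ext (bal2 (p.1 + q.1)) (bal3 (p.2 + q.2)) := by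
  decide +kernel

theorem injOn_shift : ∀ p ∈ bitTritFinset, Set.InjOn
    (fun q : ℤ × ℤ => (bal2 (p.1 + q.1), bal3 (p.2 + q.2))) bitTritFinset := by
  have h : ∀ p ∈ bitTritFinset, ∀ q ∈ bitTritFinset, ∀ r ∈ bitTritFinset,
      (bal2 (p.1 + q.1), bal3 (p.2 + q.2)) = (bal2 (p.1 + r.1), bal3 (p.2 + r.2)) → q = r := by
    decide +kernel
  exact fun p hp q hq r hr => h p hp q hq r hr

theorem mapsTo_shift : ∀ p ∈ bitTritFinset, ∀ q ∈ bitTritFinset,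
    (bal2 (p.1 + q.1), bal3 (p.2 + q.2)) ∈ bitTritFinset := by
  decide +kernel

theorem bijOn_psi {v : Fin 2 × Fin 3 → ℤ} (hv : v ∈ validE) :
    Set.BijOn (fun p : ℤ × ℤ => psi p.1 p.2 v) bitTritFinset validE := by
  rw [← coe_image_ext, Finset.coe_image] at hv ⊢
  obtain ⟨p, hp, rfl⟩ := hv
  have hshift : Set.BijOn (fun q : ℤ × ℤ => (bal2 (p.1 + q.1), bal3 (p.2 + q.2)))
      bitTritFinset bitTritFinset :=
    ⟨mapsTo_shift p hp, injOn_shift p hp,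
      Finset.surjOn_of_injOn_of_card_le _ (mapsTo_shift p hp) (injOn_shift p hp) le_rfl⟩
  exact (injOn_ext.bijOn_image.comp hshift).congr fun q hq => (psi_ext_s9 p hp q hq).symm

/-- A bijection between finite sets pushes the uniform distribution to the uniform distribution. -/
theorem PMF.map_uniformOfFinset_of_bijOn {α β : Type*} {s : Finset α} {t : Finset β}
    (f : α → β) (h : Set.BijOn f s t) (hs : s.Nonempty) (ht : t.Nonempty) :
    PMF.map f (PMF.uniformOfFinset s hs) = PMF.uniformOfFinset t ht := by
  classical
  have hcard : s.card = t.card := Finset.card_bij (fun a _ => f a) (fun a ha => h.mapsTo ha)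
    (fun a ha b hb hab => h.injOn ha hb hab) (fun b hb => by simpa using h.surjOn hb)
  ext b
  rw [PMF.map_apply, PMF.uniformOfFinset_apply]
  split_ifs with hb
  · obtain ⟨a, ha, rfl⟩ := h.surjOn hb
    rw [tsum_eq_single a]
    · rw [if_pos rfl, PMF.uniformOfFinset_apply_of_mem hs ha, hcard]
    · intro c hc
      split_ifs with hac
      · exact PMF.uniformOfFinset_apply_of_notMem hs fun hcs =>
          hc (h.injOn hcs ha hac.symm)
      · rfl
  · refine ENNReal.tsum_eq_zero.2 fun a => ?_
    split_ifs with hab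
    · exact PMF.uniformOfFinset_apply_of_notMem hs fun has => hb (hab ▸ h.mapsTo has)
    · rfl

/-- `(t, z) ↦ ext(t, z)` is injective on `{0,1} × {-1,0,1}` (so `valid_e` has exactly
`6` elements), and for every fixed `v ∈ valid_e` the map `(b, e) ↦ ψ_{b,e}(v)` is a
bijection from `{0,1} × {-1,0,1}` onto `valid_e`; consequently, if `v ∈ valid_e` and
`(b, e)` is uniform on `{0,1} × {-1,0,1}`, then `ψ_{b,e}(v)` is uniform on `valid_e`. -/
theorem ext_injective_psi_bijective_uniform :
    Set.InjOn (fun p : ℤ × ℤ => ext p.1 p.2) bitTrit ∧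
    Nat.card validE = 6 ∧
    ∀ v ∈ validE,
      Set.BijOn (fun p : ℤ × ℤ => psi p.1 p.2 v) bitTrit validE ∧
      ∀ (hT : bitTritFinset.Nonempty)
        (hV : (bitTritFinset.image fun p : ℤ × ℤ => ext p.1 p.2).Nonempty),
        PMF.map (fun p : ℤ × ℤ => psi p.1 p.2 v) (PMF.uniformOfFinset bitTritFinset hT) =
          PMF.uniformOfFinset (bitTritFinset.image fun p : ℤ × ℤ => ext p.1 p.2) hV := by
  rw [← coe_bitTritFinset]
  refine ⟨injOn_ext, ?_, fun v hv => ⟨bijOn_psi hv, fun hT hV =>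
    PMF.map_uniformOfFinset_of_bijOn _ (coe_image_ext ▸ bijOn_psi hv) hT hV⟩⟩
  rw [← coe_image_ext, Nat.card_coe_set_eq, Set.ncard_coe_finset,
    Finset.card_image_of_injOn injOn_ext]
  rfl
end
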